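/- Let m_N, k_N be sequences of natural numbers with p_N := m_N·k_N → ∞ and p_N = o(N). For each N let A_N be Haar-distributed on O(N), let y_{i,j}^{(N)} = √N·(A_N)_{i,j} for 1 ≤ i ≤ m_N, 1 ≤ j ≤ k_N, and let ν_N = (1/p_N) ∑_{i=1}^{m_N} ∑_{j=1}^{k_N} δ_{y_{i,j}^{(N)}} be the random empirical measure. Then for every closed set C in 𝒫(ℝ) (weak topology), limsup_{N→∞} (1/p_N)·log ℙ(ν_N ∈ C) ≤ −inf_{μ∈C} H(μ|γ), where γ is the standard Gaussian measure on ℝ and H(μ|γ) is the relative entropy of μ with respect to γ (equal to ∫ log(dμ/dγ) dμ if μ ≪ γ and +∞ otherwise). -/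

import Mathlib

open MeasureTheory ProbabilityTheory Filter Matrix Asymptotics

noncomputable instance matrixMeasurableSpace {N : ℕ} :
    MeasurableSpace (Matrix (Fin N) (Fin N) ℝ) :=
  show MeasurableSpace (Fin N → Fin N → ℝ) from inferInstance

/-- The `(i,j)` entry of `A` (with `0`-based indices), or `0` if out of range. -/
def entryOrZero {N : ℕ} (A : Matrix (Fin N) (Fin N) ℝ) (i j : ℕ) : ℝ :=
  if h : i < N ∧ j < N then A ⟨i, h.1⟩ ⟨j, h.2⟩ else 0

/-- The empirical measure `(1/(m*k)) ∑_{i<m} ∑_{j<k} δ_{√N · A_{i,j}}`. -/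
noncomputable def empMeas (m k N : ℕ) (A : Matrix (Fin N) (Fin N) ℝ) : Measure ℝ :=
  ((m * k : ℕ) : ENNReal)⁻¹ •
    ∑ i ∈ Finset.range m, ∑ j ∈ Finset.range k,
      Measure.dirac (Real.sqrt N * entryOrZero A i j)

open scoped Classical in
/-- The empirical measure as a probability measure (junk value if `m*k = 0`). -/
noncomputable def empPM (m k N : ℕ) (A : Matrix (Fin N) (Fin N) ℝ) :
    ProbabilityMeasure ℝ :=
  if h : IsProbabilityMeasure (empMeas m k N A) then ⟨empMeas m k N A, h⟩
  else ⟨Measure.dirac 0, inferInstance⟩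

open scoped Classical in
/-- Relative entropy `H(μ|ν) = ∫ log (dμ/dν) dμ` if `μ ≪ ν` (and the integral exists),
`+∞` otherwise. -/
noncomputable def relEntropy (μ ν : Measure ℝ) : EReal :=
  if μ ≪ ν ∧ Integrable (llr μ ν) μ then ((∫ x, llr μ ν x ∂μ : ℝ) : EReal) else ⊤

lemma abs_clamp_sub_clamp_le (B x y : ℝ) (hx : |x| ≤ B) :
    |x - max (-B) (min B y)| ≤ |x - y| := by
  have hx' := abs_le.1 hx
  rcases abs_cases (x - y) with h | h <;> rcases max_cases (-B) (min B y) with h1 | h1 <;>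
    rcases min_cases B y with h2 | h2 <;> rw [abs_le] <;> constructor <;> linarith

lemma abs_exp_sub_exp_le {B x y : ℝ} (hx : |x| ≤ B) (hy : |y| ≤ B) :
    |Real.exp x - Real.exp y| ≤ Real.exp B * |x - y| := by
  wlog h : y ≤ x generalizing x y
  · rw [abs_sub_comm, abs_sub_comm x]
    exact this hy hx (le_of_not_ge h)
  have h1 : Real.exp y ≤ Real.exp x := Real.exp_le_exp.2 h
  rw [abs_of_nonneg (by linarith), abs_of_nonneg (by linarith)]
  have h2 : y - x + 1 ≤ Real.exp (y - x) := Real.add_one_le_exp _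
  have h3 : Real.exp y = Real.exp x * Real.exp (y - x) := by rw [← Real.exp_add]; ring_nf
  have h4 : Real.exp x ≤ Real.exp B := Real.exp_le_exp.2 ((le_abs_self x).trans hx)
  have h5 := Real.exp_pos x
  rw [h3]
  nlinarith [mul_le_mul_of_nonneg_left h2 h5.le, mul_le_mul_of_nonneg_right h4 (sub_nonneg.2 h)]

lemma integrable_of_abs_le {Ω : Type*} [MeasurableSpace Ω] {ν : Measure Ω} [IsFiniteMeasure ν]
    {f : Ω → ℝ} (hf : Measurable f) {B : ℝ} (hB : ∀ x, |f x| ≤ B) : Integrable f ν :=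
  Integrable.of_bound hf.aestronglyMeasurable B (ae_of_all _ hB)

/-- The inequality `∫ f dν ≤ a + log ∫ e^f dγ` passes from bounded uniformly continuous functions
to bounded measurable ones. -/
lemma integral_le_add_log_of_uniformContinuous {ν γ : Measure ℝ} [IsProbabilityMeasure ν]
    [IsProbabilityMeasure γ] {a : ℝ}
    (H : ∀ f : ℝ → ℝ, UniformContinuous f → (∃ B, ∀ x, |f x| ≤ B) →
      ∫ x, f x ∂ν ≤ a + Real.log (∫ x, Real.exp (f x) ∂γ))
    {f : ℝ → ℝ} (hf : Measurable f) {B : ℝ} (hB : ∀ x, |f x| ≤ B) :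
    ∫ x, f x ∂ν ≤ a + Real.log (∫ x, Real.exp (f x) ∂γ) := by
  have hint : Integrable f (ν + γ) := integrable_of_abs_le hf hB
  have hB0 : 0 ≤ B := (abs_nonneg _).trans (hB 0)
  have hpos : ∀ n : ℕ, (0 : ℝ) < 1 / ((n : ℝ) + 1) := fun n => by positivity
  choose g hgs hgd hgc hgi using fun n : ℕ =>
    hint.exists_hasCompactSupport_integral_sub_le (hpos n)
  set u : ℕ → ℝ → ℝ := fun n x => max (-B) (min B (g n x)) with hu
  have huB : ∀ n x, |u n x| ≤ B := by
    intro n x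
    rw [abs_le]
    exact ⟨le_max_left _ _, max_le (by linarith) (min_le_left _ _)⟩
  have huc : ∀ n, UniformContinuous (u n) := by
    intro n
    have h1 : UniformContinuous (g n) :=
      (hgs n).uniformContinuous_of_continuous (hgc n)
    have h2 : LipschitzWith 1 (fun y : ℝ => max (-B) (min B y)) :=
      (LipschitzWith.id.const_min B).const_max (-B)
    exact h2.uniformContinuous.comp h1
  have hum : ∀ n, Measurable (u n) := fun n => (huc n).continuous.measurable
  have hfg : ∀ n, Integrable (fun x => |f x - g n x|) (ν + γ) := fun n => (hint.sub (hgi n)).abs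
  have hcmp : ∀ n, ∀ ρ : Measure ℝ, ρ ≤ ν + γ → ∫ x, |f x - u n x| ∂ρ ≤ 1 / ((n : ℝ) + 1) := by
    intro n ρ hρ
    refine le_trans ?_ (hgd n)
    calc ∫ x, |f x - u n x| ∂ρ ≤ ∫ x, |f x - g n x| ∂ρ := by
          refine integral_mono_of_nonneg (ae_of_all _ fun x => abs_nonneg _)
            ((hfg n).mono_measure hρ)
            (ae_of_all _ fun x => abs_clamp_sub_clamp_le B _ _ (hB x))
      _ ≤ ∫ x, ‖f x - g n x‖ ∂(ν + γ) :=
          integral_mono_measure hρ (ae_of_all _ fun x => abs_nonneg _) (hfg n)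
  have hlim : Tendsto (fun n : ℕ => 1 / ((n : ℝ) + 1)) atTop (nhds 0) :=
    tendsto_one_div_add_atTop_nhds_zero_nat
  have hν : ν ≤ ν + γ := Measure.le_add_right le_rfl
  have hγ : γ ≤ ν + γ := Measure.le_add_left le_rfl
  have t1 : Tendsto (fun n => ∫ x, u n x ∂ν) atTop (nhds (∫ x, f x ∂ν)) := by
    rw [tendsto_iff_dist_tendsto_zero]
    refine squeeze_zero (fun _ => dist_nonneg) (fun n => ?_) hlim
    rw [dist_comm, Real.dist_eq, ← integral_sub (integrable_of_abs_le hf hB)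
      (integrable_of_abs_le (hum n) (huB n))]
    exact (abs_integral_le_integral_abs).trans (hcmp n ν hν)
  have hexpB : ∀ h : ℝ → ℝ, (∀ x, |h x| ≤ B) → ∀ x, |Real.exp (h x)| ≤ Real.exp B := by
    intro h hh x
    rw [abs_of_pos (Real.exp_pos _)]
    exact Real.exp_le_exp.2 ((le_abs_self _).trans (hh x))
  have t2 : Tendsto (fun n => ∫ x, Real.exp (u n x) ∂γ) atTop
      (nhds (∫ x, Real.exp (f x) ∂γ)) := by
    rw [tendsto_iff_dist_tendsto_zero]
    refine squeeze_zero (fun _ => dist_nonneg) (fun n => ?_)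
      (by simpa only [mul_zero] using hlim.const_mul (Real.exp B))
    rw [dist_comm, Real.dist_eq, ← integral_sub (integrable_of_abs_le hf.exp (hexpB f hB))
      (integrable_of_abs_le (hum n).exp (hexpB _ (huB n)))]
    refine (abs_integral_le_integral_abs).trans ?_
    calc ∫ x, |Real.exp (f x) - Real.exp (u n x)| ∂γ ≤ ∫ x, Real.exp B * |f x - u n x| ∂γ := by
          refine integral_mono_of_nonneg (ae_of_all _ fun x => abs_nonneg _) ?_
            (ae_of_all _ fun x => abs_exp_sub_exp_le (hB x) (huB n x))
          exact ((integrable_of_abs_le hf hB).sub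
            (integrable_of_abs_le (hum n) (huB n))).abs.const_mul _
      _ ≤ Real.exp B * (1 / ((n : ℝ) + 1)) := by
          rw [integral_const_mul]
          exact mul_le_mul_of_nonneg_left (hcmp n γ hγ) (Real.exp_pos _).le
  have hne : ∫ x, Real.exp (f x) ∂γ ≠ 0 :=
    (integral_exp_pos (integrable_of_abs_le hf.exp (hexpB f hB))).ne'
  exact le_of_tendsto_of_tendsto' t1 ((t2.log hne).const_add a) fun n => H _ (huc n) ⟨B, huB n⟩

/-- Pointwise Young inequality used to truncate the relative entropy. -/
lemma mul_log_clamp_nonneg {n r : ℝ} (hn : 1 ≤ n) :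
    0 ≤ r * Real.log (max n⁻¹ (min n r)) - max n⁻¹ (min n r) + 1 := by
  have hn0 : 0 < n := by linarith
  have hinv : n⁻¹ ≤ 1 := inv_le_one_of_one_le₀ hn
  set c := max n⁻¹ (min n r) with hc
  have hc0 : 0 < c := lt_of_lt_of_le (by positivity) (le_max_left _ _)
  have h1 : c - 1 ≤ c * Real.log c := by
    have := Real.log_le_sub_one_of_pos (inv_pos.2 hc0)
    rw [Real.log_inv] at this
    have h2 : c * c⁻¹ = 1 := mul_inv_cancel₀ hc0.ne'
    nlinarith
  rcases le_total 1 c with h | h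
  · rcases lt_or_ge r c with h2 | h2
    · have h3 : c = 1 := by
        rcases max_cases n⁻¹ (min n r) with h3 | h3 <;> rcases min_cases n r with h4 | h4 <;>
          linarith
      simp [h3]
    nlinarith [mul_le_mul_of_nonneg_right h2 (Real.log_nonneg h)]
  · rcases lt_or_ge c r with h2 | h2
    · have h3 : c = 1 := by
        rcases max_cases n⁻¹ (min n r) with h3 | h3 <;> rcases min_cases n r with h4 | h4 <;>
          linarith
      simp [h3]
    nlinarith [mul_le_mul_of_nonneg_right h2 (neg_nonneg.2 (Real.log_nonpos hc0.le h))]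

lemma relEntropy_le_of_forall_measurable {ν γ : Measure ℝ} [IsProbabilityMeasure ν]
    [IsProbabilityMeasure γ] {a : ℝ}
    (H : ∀ f : ℝ → ℝ, Measurable f → (∃ B, ∀ x, |f x| ≤ B) →
      ∫ x, f x ∂ν ≤ a + Real.log (∫ x, Real.exp (f x) ∂γ)) :
    relEntropy ν γ ≤ a := by
  have hac : ν ≪ γ := by
    refine Measure.AbsolutelyContinuous.mk fun s hs h0 => ?_
    by_contra hne
    have hpos : 0 < ν.real s := by
      rw [measureReal_def]; exact ENNReal.toReal_pos hne (measure_ne_top _ _)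
    have key : ∀ t : ℝ, t * ν.real s ≤ a := by
      intro t
      have h1 := H (s.indicator fun _ => t) (measurable_const.indicator hs)
        ⟨|t|, fun x => by
          by_cases hx : x ∈ s <;> simp [hx]⟩
      have h2 : ∫ x, Real.exp (s.indicator (fun _ => t) x) ∂γ = 1 := by
        rw [integral_congr_ae (g := fun _ => (1 : ℝ))]
        · simp
        · have : ∀ᵐ x ∂γ, x ∉ s := measure_eq_zero_iff_ae_notMem.1 h0
          filter_upwards [this] with x hx
          simp [hx]
      rw [h2, integral_indicator hs] at h1
      simpa [mul_comm] using h1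
    have := key ((|a| + 1) / ν.real s)
    rw [div_mul_cancel₀ _ hpos.ne'] at this
    linarith [le_abs_self a]
  set ρ : ℝ → ℝ := fun x => (ν.rnDeriv γ x).toReal with hρ
  have hρm : Measurable ρ := (Measure.measurable_rnDeriv _ _).ennreal_toReal
  have hρ0 : ∀ x, 0 ≤ ρ x := fun x => ENNReal.toReal_nonneg
  have hρi : Integrable ρ γ := Measure.integrable_toReal_rnDeriv
  set c : ℕ → ℝ → ℝ := fun n x => max ((n : ℝ) + 1)⁻¹ (min ((n : ℝ) + 1) (ρ x)) with hc
  have hcm : ∀ n, Measurable (c n) := fun n => measurable_const.max (measurable_const.min hρm)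
  have hc0 : ∀ (n : ℕ) (x : ℝ), ((n : ℝ) + 1)⁻¹ ≤ c n x := fun n x => le_max_left _ _
  have hcp : ∀ n x, 0 < c n x := fun n x => lt_of_lt_of_le (by positivity) (hc0 n x)
  have hc1 : ∀ (n : ℕ) (x : ℝ), c n x ≤ (n : ℝ) + 1 := by
    intro n x
    have : ((n : ℝ) + 1)⁻¹ ≤ 1 := inv_le_one_of_one_le₀ (by linarith [n.cast_nonneg (α := ℝ)])
    refine max_le (by linarith [n.cast_nonneg (α := ℝ)]) (min_le_left _ _)
  set h : ℕ → ℝ → ℝ := fun n x => ρ x * Real.log (c n x) - c n x + 1 with hh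
  have hh0 : ∀ n x, 0 ≤ h n x := fun n x =>
    mul_log_clamp_nonneg (by linarith [n.cast_nonneg (α := ℝ)])
  have hlogB : ∀ (n : ℕ) (x : ℝ), |Real.log (c n x)| ≤ Real.log ((n : ℝ) + 1) := by
    intro n x
    rw [abs_le, ← Real.log_inv]
    exact ⟨Real.log_le_log (by positivity) (hc0 n x), Real.log_le_log (hcp n x) (hc1 n x)⟩
  have hci : ∀ n, Integrable (c n) γ := fun n => integrable_of_abs_le (hcm n) (B := n + 1)
    fun x => by rw [abs_of_pos (hcp n x)]; exact hc1 n x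
  have hli : ∀ n, Integrable (fun x => ρ x * Real.log (c n x)) γ := fun n =>
    hρi.mul_bdd (c := Real.log ((n : ℝ) + 1)) (hcm n).log.aestronglyMeasurable
      (ae_of_all _ (hlogB n))
  have hhi : ∀ n, Integrable (h n) γ := fun n => ((hli n).sub (hci n)).add (integrable_const 1)
  have hint : ∀ n, ∫ x, h n x ∂γ ≤ a := by
    intro n
    have h1 := H (fun x => Real.log (c n x)) (hcm n).log ⟨_, hlogB n⟩
    have h2 : ∫ x, ρ x * Real.log (c n x) ∂γ = ∫ x, Real.log (c n x) ∂ν := by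
      simpa using integral_rnDeriv_smul (f := fun x => Real.log (c n x)) hac
    have h3 : ∫ x, h n x ∂γ = ∫ x, Real.log (c n x) ∂ν - ∫ x, c n x ∂γ + 1 := by
      rw [← h2, ← integral_sub (hli n) (hci n)]
      simp only [hh]
      rw [integral_add (f := fun x => ρ x * Real.log (c n x) - c n x) ((hli n).sub (hci n))
        (integrable_const 1)]
      simp
    simp only [Real.exp_log (hcp n _)] at h1
    have h4 : 0 < ∫ x, c n x ∂γ := by
      have : ∫ x, ((n : ℝ) + 1)⁻¹ ∂γ ≤ ∫ x, c n x ∂γ :=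
        integral_mono (integrable_const _) (hci n) (hc0 n)
      simp only [integral_const, probReal_univ, smul_eq_mul, one_mul] at this
      exact lt_of_lt_of_le (by positivity) this
    linarith [Real.log_le_sub_one_of_pos h4]
  have hlim : ∀ x, Tendsto (fun n => h n x) atTop (nhds (InformationTheory.klFun (ρ x))) := by
    intro x
    have hnt : Tendsto (fun n : ℕ => ((n : ℝ) + 1)) atTop atTop :=
      tendsto_atTop_add_const_right _ _ tendsto_natCast_atTop_atTop
    have hct : Tendsto (fun n => c n x) atTop (nhds (ρ x)) := by
      have e1 : (fun n : ℕ => min ((n : ℝ) + 1) (ρ x)) =ᶠ[atTop] fun _ => ρ x := by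
        filter_upwards [hnt.eventually_ge_atTop (ρ x)] with n hn
        exact min_eq_right hn
      have := (tendsto_inv_atTop_zero.comp hnt).max (tendsto_const_nhds.congr' e1.symm)
      simpa [hc, hρ0 x, Function.comp_def] using this
    rcases eq_or_lt_of_le (hρ0 x) with h0 | h0
    · have : (fun n => h n x) = fun n => - c n x + 1 := by
        ext n; simp [hh, ← h0]
      rw [this, ← h0, InformationTheory.klFun_zero]
      rw [← h0] at hct
      simpa using hct.neg.add_const 1
    · have := ((hct.log h0.ne').const_mul (ρ x)).sub hct |>.add_const 1
      have e : InformationTheory.klFun (ρ x) = ρ x * Real.log (ρ x) - ρ x + 1 := by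
        rw [InformationTheory.klFun]; ring
      rw [e]; exact this
  have ha0 : 0 ≤ a := by simpa using H 0 measurable_zero ⟨0, by simp⟩
  have hkl : InformationTheory.klDiv ν γ ≤ ENNReal.ofReal a := by
    rw [InformationTheory.klDiv_eq_lintegral_klFun_of_ac hac]
    calc ∫⁻ x, ENNReal.ofReal (InformationTheory.klFun (ρ x)) ∂γ
        = ∫⁻ x, liminf (fun n => ENNReal.ofReal (h n x)) atTop ∂γ := by
          refine lintegral_congr fun x => ?_
          exact ((ENNReal.tendsto_ofReal (hlim x)).liminf_eq).symm
      _ ≤ liminf (fun n => ∫⁻ x, ENNReal.ofReal (h n x) ∂γ) atTop :=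
          lintegral_liminf_le fun n =>
            (((hρm.mul (hcm n).log).sub (hcm n)).add_const 1).ennreal_ofReal
      _ ≤ liminf (fun _ : ℕ => ENNReal.ofReal a) atTop := by
          refine liminf_le_liminf (Eventually.of_forall fun n => ?_)
          rw [← ofReal_integral_eq_lintegral_ofReal (hhi n) (ae_of_all _ (hh0 n))]
          exact ENNReal.ofReal_le_ofReal (hint n)
      _ = ENNReal.ofReal a := liminf_const _
  have hne : InformationTheory.klDiv ν γ ≠ ⊤ := ne_top_of_le_ne_top ENNReal.ofReal_ne_top hkl
  have hfin := InformationTheory.klDiv_ne_top_iff.1 hne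
  rw [relEntropy, if_pos hfin]
  rw [← InformationTheory.toReal_klDiv_of_measure_eq hac (by simp)]
  exact EReal.coe_le_coe_iff.2 (ENNReal.toReal_le_of_le_ofReal ha0 hkl)

/-- Donsker–Varadhan: the relative entropy is approximated from below by
`∫ f dν - log ∫ e^f dγ` over bounded uniformly continuous `f`. -/
lemma exists_uniformContinuous_of_lt_relEntropy {ν γ : Measure ℝ} [IsProbabilityMeasure ν]
    [IsProbabilityMeasure γ] {a : ℝ} (h : (a : EReal) < relEntropy ν γ) :
    ∃ f : ℝ → ℝ, UniformContinuous f ∧ (∃ B, ∀ x, |f x| ≤ B) ∧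
      a + Real.log (∫ x, Real.exp (f x) ∂γ) < ∫ x, f x ∂ν := by
  by_contra! hcon
  refine absurd h (not_lt.2 (relEntropy_le_of_forall_measurable fun f hf ⟨B, hB⟩ => ?_))
  exact integral_le_add_log_of_uniformContinuous (fun f hf hB => hcon f hf hB) hf hB

/-- The law of a family of independent standard Gaussian variables. -/
noncomputable def stdGaussianPi (ι : Type*) [Fintype ι] : Measure (ι → ℝ) :=
  Measure.pi fun _ => gaussianReal 0 1

instance (ι : Type*) [Fintype ι] : IsProbabilityMeasure (stdGaussianPi ι) := by
  unfold stdGaussianPi; infer_instance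

lemma stdGaussianPi_map_linearEquiv {ι : Type*} [Fintype ι] (L : (ι → ℝ) ≃ₗ[ℝ] (ι → ℝ))
    (hL : ∀ x, ∑ i, L x i ^ 2 = ∑ i, x i ^ 2) :
    (stdGaussianPi ι).map L = stdGaussianPi ι := by
  let e : EuclideanSpace ℝ ι ≃ₗᵢ[ℝ] EuclideanSpace ℝ ι :=
    { toLinearEquiv := (WithLp.linearEquiv 2 ℝ (ι → ℝ)).trans
        (L.trans (WithLp.linearEquiv 2 ℝ (ι → ℝ)).symm)
      norm_map' := fun x => by
        rw [← sq_eq_sq₀ (norm_nonneg _) (norm_nonneg _), EuclideanSpace.real_norm_sq_eq,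
          EuclideanSpace.real_norm_sq_eq]
        exact hL _ }
  have he := stdGaussian_map e
  rw [← map_pi_eq_stdGaussian, Measure.map_map (by fun_prop) (by fun_prop)] at he
  have hL' : Measurable L := (LinearMap.continuous_of_finiteDimensional L.toLinearMap).measurable
  have h2 := congrArg (Measure.map (WithLp.ofLp : EuclideanSpace ℝ ι → ι → ℝ)) he
  rw [Measure.map_map (by fun_prop) (by fun_prop),
    Measure.map_map (by fun_prop) (by fun_prop)] at h2
  have e1 : (WithLp.ofLp : EuclideanSpace ℝ ι → ι → ℝ) ∘ e ∘ WithLp.toLp 2 = L := by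
    ext x; rfl
  have e2 : (WithLp.ofLp : EuclideanSpace ℝ ι → ι → ℝ) ∘ WithLp.toLp 2 = id := by
    ext x; rfl
  rw [e1, e2, Measure.map_id] at h2
  exact h2

lemma sum_sq_eq_trace {m n : Type*} [Fintype m] [Fintype n] (Z : Matrix m n ℝ) :
    ∑ i, ∑ j, Z i j ^ 2 = (Zᵀ * Z).trace := by
  rw [Finset.sum_comm]
  simp [Matrix.trace, Matrix.mul_apply, sq]

lemma sum_sq_mul_of_transpose_mul_self {N k : ℕ} {A : Matrix (Fin N) (Fin N) ℝ} (hA : Aᵀ * A = 1)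
    (X : Matrix (Fin N) (Fin k) ℝ) :
    ∑ i, ∑ j, (A * X) i j ^ 2 = ∑ i, ∑ j, X i j ^ 2 := by
  rw [sum_sq_eq_trace, sum_sq_eq_trace, Matrix.transpose_mul, Matrix.mul_assoc,
    ← Matrix.mul_assoc Aᵀ, hA, Matrix.one_mul]

/-- Left multiplication by an orthogonal matrix preserves the law of a Gaussian matrix. -/
lemma stdGaussianPi_map_mul {N k : ℕ} {A : Matrix (Fin N) (Fin N) ℝ} (hA : A * Aᵀ = 1) :
    (stdGaussianPi (Fin N × Fin k)).map
      (fun g q => (A * Matrix.of fun i j => g (i, j)) q.1 q.2) = stdGaussianPi (Fin N × Fin k) := by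
  have hA' : Aᵀ * A = 1 := mul_eq_one_comm.1 hA
  let L : (Fin N × Fin k → ℝ) ≃ₗ[ℝ] (Fin N × Fin k → ℝ) :=
    { toFun := fun g q => (A * Matrix.of fun i j => g (i, j)) q.1 q.2
      invFun := fun g q => (Aᵀ * Matrix.of fun i j => g (i, j)) q.1 q.2
      map_add' := fun x y => by
        ext q
        simp [Matrix.mul_apply, mul_add, Finset.sum_add_distrib]
      map_smul' := fun c x => by
        ext q
        simp [Matrix.mul_apply, Finset.mul_sum, mul_left_comm]
      left_inv := fun x => by
        ext q
        change (Aᵀ * (A * Matrix.of fun i j => x (i, j))) q.1 q.2 = x q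
        rw [← Matrix.mul_assoc, hA', Matrix.one_mul]; rfl
      right_inv := fun x => by
        ext q
        change (A * (Aᵀ * Matrix.of fun i j => x (i, j))) q.1 q.2 = x q
        rw [← Matrix.mul_assoc, hA, Matrix.one_mul]; rfl }
  refine stdGaussianPi_map_linearEquiv L fun x => ?_
  rw [Fintype.sum_prod_type, Fintype.sum_prod_type]
  exact sum_sq_mul_of_transpose_mul_self hA' (Matrix.of fun i j => x (i, j))

/-- Chernoff bound for partial sums of functions of independent standard Gaussian variables. -/
lemma stdGaussianPi_sum_ge_le {ι : Type*} [Fintype ι] [DecidableEq ι] (s : Finset ι) {f : ℝ → ℝ}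
    (hi : Integrable (fun x => Real.exp (f x)) (gaussianReal 0 1)) (t : ℝ) :
    stdGaussianPi ι {g | t ≤ ∑ i ∈ s, f (g i)} ≤
      ENNReal.ofReal (Real.exp (-t) * (∫ x, Real.exp (f x) ∂gaussianReal 0 1) ^ s.card) := by
  let h : ι → ℝ → ℝ := fun i => if i ∈ s then fun x => Real.exp (f x) else fun _ => 1
  have hh : ∀ g : ι → ℝ, ∏ i, h i (g i) = Real.exp (∑ i ∈ s, f (g i)) := by
    intro g
    rw [Real.exp_sum, ← Finset.prod_subset (Finset.subset_univ s)]
    · exact Finset.prod_congr rfl fun i hi => by simp [h, hi]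
    · intro i _ hi; simp [h, hi]
  have hint : ∫ g, ∏ i, h i (g i) ∂stdGaussianPi ι =
      (∫ x, Real.exp (f x) ∂gaussianReal 0 1) ^ s.card := by
    rw [stdGaussianPi, integral_fintype_prod_eq_prod (f := h), ← Finset.prod_const,
      ← Finset.prod_subset (Finset.subset_univ s)]
    · exact Finset.prod_congr rfl fun i hi => by simp [h, hi]
    · intro i _ hi; simp [h, hi]
  have hI : Integrable (fun g => ∏ i, h i (g i)) (stdGaussianPi ι) := by
    rw [stdGaussianPi]
    refine Integrable.fintype_prod fun i => ?_
    by_cases hs : i ∈ s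
    · simpa [h, hs] using hi
    · simp [h, hs]
  have hI' := hI
  simp_rw [hh] at hI
  have h1 := measure_ge_le_exp_mul_mgf (μ := stdGaussianPi ι) (X := fun g => ∑ i ∈ s, f (g i))
    (t := 1) t zero_le_one (by simpa using hI)
  simp only [mgf, one_mul, neg_mul] at h1
  simp_rw [hh] at hint
  rw [hint] at h1
  rw [← ofReal_measureReal]
  exact ENNReal.ofReal_le_ofReal h1

lemma exists_integrable_exp_mul_sq_gaussianReal :
    ∃ c : ℝ, 0 < c ∧ Integrable (fun x => Real.exp (c * x ^ 2)) (gaussianReal 0 1) := by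
  obtain ⟨c, hc, h⟩ := IsGaussian.exists_integrable_exp_sq (gaussianReal 0 1)
  exact ⟨c, hc, by simpa using h⟩

/-- Exponential tail bound for the sum of squares of standard Gaussian variables: the decay rate
per variable is as large as we want. -/
lemma exists_stdGaussianPi_sum_sq_ge_le (a : ℝ) : ∃ M : ℝ, 0 < M ∧
    ∀ (ι : Type) [Fintype ι] [DecidableEq ι] (s : Finset ι),
      stdGaussianPi ι {g | M * s.card ≤ ∑ i ∈ s, g i ^ 2} ≤
        ENNReal.ofReal (Real.exp (-(a * s.card))) := by
  obtain ⟨c, hc, hi⟩ := exists_integrable_exp_mul_sq_gaussianReal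
  set K := ∫ x, Real.exp (c * x ^ 2) ∂gaussianReal 0 1 with hK
  have hK0 : 0 < K := integral_exp_pos hi
  refine ⟨max 1 ((a + Real.log K) / c), lt_of_lt_of_le one_pos (le_max_left _ _), ?_⟩
  intro ι _ _ s
  set M := max 1 ((a + Real.log K) / c) with hM
  have hM1 : a + Real.log K ≤ c * M := by
    have := le_max_right 1 ((a + Real.log K) / c)
    rw [div_le_iff₀ hc] at this
    linarith
  have h1 := stdGaussianPi_sum_ge_le s (f := fun x => c * x ^ 2) hi
    (c * (M * s.card))
  have e : {g : ι → ℝ | c * (M * s.card) ≤ ∑ i ∈ s, c * g i ^ 2} =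
      {g | M * s.card ≤ ∑ i ∈ s, g i ^ 2} := by
    ext g
    simp only [Set.mem_ofPred_eq, ← Finset.mul_sum]
    exact mul_le_mul_iff_right₀ hc
  rw [e] at h1
  refine h1.trans (ENNReal.ofReal_le_ofReal ?_)
  rw [← hK, ← Real.exp_log hK0, ← Real.exp_nat_mul, ← Real.exp_add, Real.exp_le_exp]
  nlinarith [s.card.cast_nonneg (α := ℝ)]

lemma map_eval_stdGaussianPi {ι : Type*} [Fintype ι] (i : ι) :
    (stdGaussianPi ι).map (fun g => g i) = gaussianReal 0 1 :=
  (measurePreserving_eval (fun _ : ι => gaussianReal 0 1) i).map_eq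

lemma integral_eval_stdGaussianPi {ι : Type*} [Fintype ι] (i : ι) {f : ℝ → ℝ} (hf : Continuous f) :
    ∫ g, f (g i) ∂stdGaussianPi ι = ∫ x, f x ∂gaussianReal 0 1 := by
  rw [← map_eval_stdGaussianPi i, integral_map (measurable_pi_apply i).aemeasurable
    hf.aestronglyMeasurable]

lemma integrable_pow_gaussianReal (n : ℕ) : Integrable (fun x => x ^ n) (gaussianReal 0 1) := by
  have h := (memLp_id_gaussianReal (μ := 0) (v := 1) (n : NNReal)).integrable_norm_pow'
  refine (integrable_norm_iff (by fun_prop)).1 ?_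
  simpa using h

lemma integrable_eval_stdGaussianPi {ι : Type*} [Fintype ι] (i : ι) {f : ℝ → ℝ} (hf : Continuous f)
    (h : Integrable f (gaussianReal 0 1)) : Integrable (fun g => f (g i)) (stdGaussianPi ι) := by
  rw [← map_eval_stdGaussianPi i, integrable_map_measure hf.aestronglyMeasurable
    (measurable_pi_apply i).aemeasurable] at h
  exact h

lemma iIndepFun_eval_stdGaussianPi {ι : Type*} [Fintype ι] :
    iIndepFun (fun i (g : ι → ℝ) => g i) (stdGaussianPi ι) :=
  iIndepFun_pi (μ := fun _ : ι => gaussianReal 0 1) (X := fun _ x => x) fun _ => aemeasurable_id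

lemma integral_sq_gaussianReal : ∫ x, x ^ 2 ∂gaussianReal 0 1 = 1 := by
  have h := variance_eq_sub (IsGaussian.memLp_two_id (μ := gaussianReal 0 1))
  simpa using h.symm

lemma memLp_two_mul_eval {ι : Type*} [Fintype ι] (a b : ι) :
    MemLp (fun g : ι → ℝ => g a * g b) 2 (stdGaussianPi ι) := by
  rw [memLp_two_iff_integrable_sq (by fun_prop)]
  refine Integrable.mono' (((integrable_eval_stdGaussianPi a (by fun_prop)
    (integrable_pow_gaussianReal 4)).add (integrable_eval_stdGaussianPi b (by fun_prop)
    (integrable_pow_gaussianReal 4)))) (by fun_prop) (ae_of_all _ fun g => ?_)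
  rw [Real.norm_eq_abs, abs_of_nonneg (sq_nonneg _)]
  simp only [Pi.add_apply]
  nlinarith [sq_nonneg (g a ^ 2 - g b ^ 2), sq_nonneg (g a ^ 2), sq_nonneg (g b ^ 2)]

lemma variance_mul_eval_le {ι : Type*} [Fintype ι] (a b : ι) :
    Var[fun g : ι → ℝ => g a * g b; stdGaussianPi ι] ≤ ∫ x, x ^ 4 ∂gaussianReal 0 1 := by
  refine (variance_le_expectation_sq (by fun_prop)).trans ?_
  have ha := integrable_eval_stdGaussianPi a (by fun_prop) (integrable_pow_gaussianReal 4)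
  have hb := integrable_eval_stdGaussianPi b (by fun_prop) (integrable_pow_gaussianReal 4)
  calc ∫ g, ((fun g : ι → ℝ => g a * g b) ^ 2) g ∂stdGaussianPi ι
      ≤ ∫ g, (1 / 2) * (g a ^ 4 + g b ^ 4) ∂stdGaussianPi ι := by
        refine integral_mono (memLp_two_mul_eval a b).integrable_sq ((ha.add hb).const_mul _) ?_
        intro g
        simp only [Pi.pow_apply]
        nlinarith [sq_nonneg (g a ^ 2 - g b ^ 2)]
    _ = ∫ x, x ^ 4 ∂gaussianReal 0 1 := by
        rw [integral_const_mul, integral_add ha hb,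
          integral_eval_stdGaussianPi a (f := fun x => x ^ 4) (by fun_prop),
          integral_eval_stdGaussianPi b (f := fun x => x ^ 4) (by fun_prop)]
        ring

lemma integral_mul_eval {ι : Type*} [Fintype ι] [DecidableEq ι] (a b : ι) :
    ∫ g, g a * g b ∂stdGaussianPi ι = if a = b then 1 else 0 := by
  split_ifs with h
  · subst h
    simp_rw [← sq]
    rw [integral_eval_stdGaussianPi a (f := fun x => x ^ 2) (by fun_prop), integral_sq_gaussianReal]
  · have h1 := (iIndepFun_eval_stdGaussianPi.indepFun h).integral_fun_mul_eq_mul_integral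
      (measurable_pi_apply a).aestronglyMeasurable (measurable_pi_apply b).aestronglyMeasurable
    rw [h1, integral_eval_stdGaussianPi a (f := fun x => x) (by fun_prop)]
    simp

/-- The entries of the empirical covariance matrix of a Gaussian matrix concentrate. -/
lemma integral_sq_cov_sub_le {N k : ℕ} (hN : 0 < N) (j l : Fin k) :
    Integrable (fun g : Fin N × Fin k → ℝ =>
      ((N : ℝ)⁻¹ * ∑ i, g (i, j) * g (i, l) - (1 : Matrix (Fin k) (Fin k) ℝ) j l) ^ 2)
      (stdGaussianPi (Fin N × Fin k)) ∧
    ∫ g, ((N : ℝ)⁻¹ * ∑ i, g (i, j) * g (i, l) - (1 : Matrix (Fin k) (Fin k) ℝ) j l) ^ 2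
      ∂stdGaussianPi (Fin N × Fin k) ≤ (∫ x, x ^ 4 ∂gaussianReal 0 1) / N := by
  have hN' : (0 : ℝ) < N := by exact_mod_cast hN
  set X : Fin N → (Fin N × Fin k → ℝ) → ℝ := fun i g => g (i, j) * g (i, l) with hX
  have hXm : ∀ i, MemLp (X i) 2 (stdGaussianPi (Fin N × Fin k)) := fun i => memLp_two_mul_eval _ _
  have hS : MemLp (fun g => ∑ i, X i g) 2 (stdGaussianPi (Fin N × Fin k)) :=
    memLp_finsetSum _ fun i _ => hXm i
  have hEX : ∀ i, ∫ g, X i g ∂stdGaussianPi (Fin N × Fin k) =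
      (1 : Matrix (Fin k) (Fin k) ℝ) j l := by
    intro i
    rw [integral_mul_eval]
    simp [Matrix.one_apply]
  have hES : ∫ g, ∑ i, X i g ∂stdGaussianPi (Fin N × Fin k) =
      N * (1 : Matrix (Fin k) (Fin k) ℝ) j l := by
    rw [integral_finsetSum _ fun i _ => (hXm i).integrable one_le_two]
    simp [hEX]
  have hind : ∀ i i', i ≠ i' → IndepFun (X i) (X i') (stdGaussianPi (Fin N × Fin k)) := by
    intro i i' hii
    have h := iIndepFun_eval_stdGaussianPi.indepFun_prodMk_prodMk (ι := Fin N × Fin k)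
      (fun a => measurable_pi_apply a) (i, j) (i, l) (i', j) (i', l)
      (by simp [hii]) (by simp [hii]) (by simp [hii]) (by simp [hii])
    exact h.comp (φ := fun q : ℝ × ℝ => q.1 * q.2) (ψ := fun q : ℝ × ℝ => q.1 * q.2)
      (by fun_prop) (by fun_prop)
  have hvar : Var[fun g => ∑ i, X i g; stdGaussianPi (Fin N × Fin k)] ≤
      N * ∫ x, x ^ 4 ∂gaussianReal 0 1 := by
    have h := IndepFun.variance_sum (X := X) (s := Finset.univ) (μ := stdGaussianPi (Fin N × Fin k))
      (fun i _ => hXm i) (fun i _ i' _ h => hind i i' h)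
    have e : (∑ i, X i) = fun g => ∑ i, X i g := by ext g; simp
    rw [e] at h
    rw [h]
    refine (Finset.sum_le_sum fun i _ => variance_mul_eval_le (i, j) (i, l)).trans ?_
    simp
  have hform : ∀ g, ((N : ℝ)⁻¹ * ∑ i, g (i, j) * g (i, l) -
      (1 : Matrix (Fin k) (Fin k) ℝ) j l) ^ 2 = (N : ℝ)⁻¹ ^ 2 *
      (∑ i, X i g - ∫ g, ∑ i, X i g ∂stdGaussianPi (Fin N × Fin k)) ^ 2 := by
    intro g
    rw [hES]
    field_simp
    rfl
  simp_rw [hform]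
  constructor
  · exact ((hS.sub (memLp_const _)).integrable_sq).const_mul _
  · rw [integral_const_mul, ← variance_eq_integral hS.aemeasurable]
    refine (mul_le_mul_of_nonneg_left hvar (by positivity)).trans (le_of_eq ?_)
    field_simp

lemma one_half_le_stdGaussianPi_cov {N k : ℕ} (hN : 0 < N) {ε : ℝ} (hε : 0 < ε)
    (h : 2 * (k : ℝ) ^ 2 * ∫ x, x ^ 4 ∂gaussianReal 0 1 ≤ N * ε ^ 2) :
    1 / 2 ≤ stdGaussianPi (Fin N × Fin k) {g | ∑ j, ∑ l, ((N : ℝ)⁻¹ * ∑ i, g (i, j) * g (i, l) -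
      (1 : Matrix (Fin k) (Fin k) ℝ) j l) ^ 2 ≤ ε ^ 2} := by
  have hN' : (0 : ℝ) < N := by exact_mod_cast hN
  set F : (Fin N × Fin k → ℝ) → ℝ := fun g => ∑ j, ∑ l, ((N : ℝ)⁻¹ * ∑ i, g (i, j) * g (i, l) -
      (1 : Matrix (Fin k) (Fin k) ℝ) j l) ^ 2 with hF
  have hF0 : ∀ g, 0 ≤ F g := fun g =>
    Finset.sum_nonneg fun j _ => Finset.sum_nonneg fun l _ => sq_nonneg _
  have hFi : Integrable F (stdGaussianPi (Fin N × Fin k)) :=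
    integrable_finsetSum _ fun j _ => integrable_finsetSum _ fun l _ =>
      (integral_sq_cov_sub_le hN j l).1
  have hFE : ∫ g, F g ∂stdGaussianPi (Fin N × Fin k) ≤ ε ^ 2 / 2 := by
    have : ∫ g, F g ∂stdGaussianPi (Fin N × Fin k) ≤
        ∑ _j : Fin k, ∑ _l : Fin k, (∫ x, x ^ 4 ∂gaussianReal 0 1) / N := by
      rw [hF, integral_finsetSum _ fun j _ => integrable_finsetSum _ fun l _ =>
        (integral_sq_cov_sub_le hN j l).1]
      refine Finset.sum_le_sum fun j _ => ?_
      rw [integral_finsetSum _ fun l _ => (integral_sq_cov_sub_le hN j l).1]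
      exact Finset.sum_le_sum fun l _ => (integral_sq_cov_sub_le hN j l).2
    refine this.trans ?_
    simp only [Finset.sum_const, Finset.card_univ, Fintype.card_fin, nsmul_eq_mul]
    rw [← mul_assoc, ← mul_div_assoc, div_le_div_iff₀ hN' two_pos]
    nlinarith
  have hmark := mul_meas_ge_le_integral_of_nonneg (ae_of_all _ hF0) hFi (ε ^ 2)
  have hsmall : (stdGaussianPi (Fin N × Fin k)).real {g | ε ^ 2 ≤ F g} ≤ 1 / 2 := by
    have h2 := hmark.trans hFE
    have h3 : 0 < ε ^ 2 := by positivity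
    nlinarith
  have hmeas : MeasurableSet {g | F g ≤ ε ^ 2} := measurableSet_le (by fun_prop) measurable_const
  have hsub : {g | F g ≤ ε ^ 2}ᶜ ⊆ {g | ε ^ 2 ≤ F g} := by
    intro g hg
    rw [Set.mem_compl_iff, Set.mem_ofPred_eq, not_le] at hg
    exact hg.le
  have hc : (stdGaussianPi (Fin N × Fin k)).real {g | F g ≤ ε ^ 2}ᶜ ≤ 1 / 2 :=
    (measureReal_mono hsub).trans hsmall
  rw [probReal_compl_eq_one_sub hmeas] at hc
  have : (1 / 2 : ℝ) ≤ (stdGaussianPi (Fin N × Fin k)).real {g | F g ≤ ε ^ 2} := by linarith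
  rw [← ofReal_measureReal]
  refine le_trans (le_of_eq ?_) (ENNReal.ofReal_le_ofReal this)
  rw [ENNReal.ofReal_div_of_pos two_pos]
  simp

lemma sum_sq_mul_le {l m n : Type*} [Fintype l] [Fintype m] [Fintype n]
    (A : Matrix l m ℝ) (B : Matrix m n ℝ) :
    ∑ i, ∑ j, (A * B) i j ^ 2 ≤ (∑ i, ∑ j, A i j ^ 2) * ∑ i, ∑ j, B i j ^ 2 := by
  have h : ∀ i j, (A * B) i j ^ 2 ≤ (∑ r, A i r ^ 2) * ∑ r, B r j ^ 2 := fun i j => by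
    rw [Matrix.mul_apply]; exact Finset.sum_mul_sq_le_sq_mul_sq _ _ _
  refine (Finset.sum_le_sum fun i _ => Finset.sum_le_sum fun j _ => h i j).trans (le_of_eq ?_)
  rw [Finset.sum_comm (f := fun i j => B i j ^ 2), Finset.sum_mul_sum]

/-- For a positive semidefinite `T`, the Frobenius distance from `T` to the identity is at most
that from `T * T`. -/
lemma sum_sq_sub_one_le_of_posSemidef {n : Type*} [Fintype n] [DecidableEq n] {T : Matrix n n ℝ}
    (hT : T.PosSemidef) :
    ∑ i, ∑ j, (T - 1) i j ^ 2 ≤ ∑ i, ∑ j, (T * T - 1) i j ^ 2 := by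
  have hTt : Tᵀ = T := by simpa using hT.isHermitian.eq
  set D := T - 1 with hD
  have hDt : Dᵀ = D := by rw [hD, Matrix.transpose_sub, hTt, Matrix.transpose_one]
  have e : T * T - 1 = D + D * T := by
    rw [hD, Matrix.sub_mul, Matrix.one_mul]; abel
  rw [e, sum_sq_eq_trace, sum_sq_eq_trace, Matrix.transpose_add, Matrix.transpose_mul, hTt, hDt,
    Matrix.add_mul, Matrix.mul_add, Matrix.mul_add, Matrix.trace_add, Matrix.trace_add,
    Matrix.trace_add]
  have h1 : 0 ≤ (D * T * D).trace := by
    have := (hT.conjTranspose_mul_mul_same D).trace_nonneg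
    simpa [hDt] using this
  have h2 : (T * D * D).trace = (D * T * D).trace := by
    rw [Matrix.mul_assoc, Matrix.trace_mul_comm, Matrix.mul_assoc, Matrix.trace_mul_comm,
      Matrix.mul_assoc, Matrix.trace_mul_comm, Matrix.mul_assoc]
  have h3 : (D * (D * T)).trace = (D * T * D).trace := Matrix.trace_mul_comm _ _
  have h4 : 0 ≤ (T * D * (D * T)).trace := by
    have : 0 ≤ ∑ i, ∑ j, (D * T) i j ^ 2 :=
      Finset.sum_nonneg fun i _ => Finset.sum_nonneg fun j _ => sq_nonneg _
    rw [sum_sq_eq_trace, Matrix.transpose_mul, hTt, hDt] at this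
    exact this
  linarith

lemma isUnit_of_sum_sq_sub_one_lt_one {n : Type*} [Fintype n] [DecidableEq n] {T : Matrix n n ℝ}
    (h : ∑ i, ∑ j, (T - 1) i j ^ 2 < 1) : IsUnit T := by
  rw [← Matrix.mulVec_injective_iff_isUnit]
  refine (injective_iff_map_eq_zero (Matrix.mulVecLin T)).2 fun v hv => ?_
  rw [Matrix.mulVecLin_apply] at hv
  have h1 := sum_sq_mul_le (T - 1) (Matrix.replicateCol Unit v)
  have h2 : (T - 1) * Matrix.replicateCol Unit v = - Matrix.replicateCol Unit v := by
    rw [← Matrix.replicateCol_mulVec, Matrix.sub_mulVec, hv, Matrix.one_mulVec]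
    ext; simp
  rw [h2] at h1
  simp only [Matrix.neg_apply, Matrix.replicateCol_apply, Finset.univ_unique, Finset.sum_singleton,
    neg_sq] at h1
  have h3 : 0 ≤ ∑ i, v i ^ 2 := Finset.sum_nonneg fun i _ => sq_nonneg _
  have h4 : ∑ i, v i ^ 2 = 0 := by nlinarith
  ext i
  exact pow_eq_zero_iff two_ne_zero |>.1
    ((Finset.sum_eq_zero_iff_of_nonneg fun i _ => sq_nonneg _).1 h4 i (Finset.mem_univ i))

/-- A matrix with orthonormal columns is the first columns of an orthogonal matrix. -/
lemma exists_orthogonal_extension {N k : ℕ} (hk : k ≤ N) {Q : Matrix (Fin N) (Fin k) ℝ}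
    (hQ : Qᵀ * Q = 1) :
    ∃ V : Matrix (Fin N) (Fin N) ℝ, V * Vᵀ = 1 ∧ V.submatrix id (Fin.castLE hk) = Q := by
  let v : Fin N → EuclideanSpace ℝ (Fin N) := fun j =>
    WithLp.toLp 2 fun i => if h : (j : ℕ) < k then Q i ⟨j, h⟩ else 0
  let s : Set (Fin N) := {j | (j : ℕ) < k}
  have hv : Orthonormal ℝ (s.domRestrict v) := by
    rw [orthonormal_iff_ite]
    rintro ⟨j, hj⟩ ⟨l, hl⟩
    have hj' : (j : ℕ) < k := hj
    have hl' : (l : ℕ) < k := hl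
    have := congrFun (congrFun hQ ⟨j, hj'⟩) ⟨l, hl'⟩
    simp only [Matrix.mul_apply, Matrix.transpose_apply, Matrix.one_apply, Fin.mk.injEq] at this
    simp only [Set.domRestrict_apply, v, PiLp.inner_apply, hj', hl', dif_pos, Subtype.mk.injEq,
      Fin.ext_iff, ← this]
    refine Finset.sum_congr rfl fun i _ => ?_
    simp [mul_comm]
  obtain ⟨b, hb⟩ := hv.exists_orthonormalBasis_extension_of_card_eq (by simp)
  refine ⟨Matrix.of fun i j => b j i, ?_, ?_⟩
  · rw [mul_eq_one_comm]
    ext j l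
    have := orthonormal_iff_ite.1 b.orthonormal j l
    rw [PiLp.inner_apply] at this
    rw [Matrix.mul_apply, Matrix.one_apply, ← this]
    refine Finset.sum_congr rfl fun i _ => ?_
    simp [mul_comm]
  · ext i j
    have hj : Fin.castLE hk j ∈ s := j.2
    simp [hb _ hj, v]

/-- Quantitative polar decomposition: if `N⁻¹ GᵀG` is close to the identity then `G` is `√N` times
the first columns of an orthogonal matrix, up to right multiplication by a matrix close to the
identity. -/
lemma exists_orthogonal_mul_near_one {N k : ℕ} (hk : k ≤ N) (hN : 0 < N) {ε : ℝ} (hε : 0 ≤ ε)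
    (hε1 : ε < 1) (G : Matrix (Fin N) (Fin k) ℝ)
    (h : ∑ j, ∑ l, ((N : ℝ)⁻¹ * ∑ i, G i j * G i l - (1 : Matrix (Fin k) (Fin k) ℝ) j l) ^ 2
      ≤ ε ^ 2) :
    ∃ V : Matrix (Fin N) (Fin N) ℝ, V * Vᵀ = 1 ∧ ∃ T : Matrix (Fin k) (Fin k) ℝ,
      ∑ i, ∑ j, (T - 1) i j ^ 2 ≤ ε ^ 2 ∧
      G = Real.sqrt N • (V.submatrix id (Fin.castLE hk) * T) := by
  have hN' : (0 : ℝ) < N := by exact_mod_cast hN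
  have hs : Real.sqrt N ≠ 0 := (Real.sqrt_pos.2 hN').ne'
  have hss : Real.sqrt N * Real.sqrt N = N := Real.mul_self_sqrt hN'.le
  set W : Matrix (Fin k) (Fin k) ℝ := (N : ℝ)⁻¹ • (Gᵀ * G) with hW
  have hWp : W.PosSemidef := by
    have := Matrix.posSemidef_conjTranspose_mul_self G
    rw [Matrix.conjTranspose_eq_transpose_of_trivial] at this
    exact this.smul (by positivity)
  obtain ⟨T, hTp, hTT⟩ : ∃ T : Matrix (Fin k) (Fin k) ℝ, T.PosSemidef ∧ T * T = W := by
    open scoped MatrixOrder in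
    exact ⟨CFC.sqrt W, (CFC.sqrt_nonneg W).posSemidef, CFC.sqrt_mul_sqrt_self W hWp.nonneg⟩
  have hTt : Tᵀ = T := by simpa using hTp.isHermitian.eq
  have hT1 : ∑ i, ∑ j, (T - 1) i j ^ 2 ≤ ε ^ 2 := by
    refine (sum_sq_sub_one_le_of_posSemidef hTp).trans (le_trans (le_of_eq ?_) h)
    rw [hTT]
    simp [hW, Matrix.mul_apply]
  have hTu : IsUnit T := isUnit_of_sum_sq_sub_one_lt_one (lt_of_le_of_lt hT1 (by nlinarith))
  have hTd : IsUnit T.det := (Matrix.isUnit_iff_isUnit_det T).1 hTu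
  have hG : Gᵀ * G = (N : ℝ) • (T * T) := by
    rw [hTT, hW, smul_smul, mul_inv_cancel₀ hN'.ne', one_smul]
  set Q : Matrix (Fin N) (Fin k) ℝ := (Real.sqrt N)⁻¹ • (G * T⁻¹) with hQ
  have hQQ : Qᵀ * Q = 1 := by
    rw [hQ, Matrix.transpose_smul, Matrix.transpose_mul, Matrix.transpose_nonsing_inv, hTt,
      Matrix.smul_mul, Matrix.mul_smul, smul_smul, Matrix.mul_assoc, ← Matrix.mul_assoc Gᵀ, hG,
      Matrix.smul_mul, Matrix.mul_smul, smul_smul, ← mul_inv, hss, inv_mul_cancel₀ hN'.ne',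
      one_smul, Matrix.mul_assoc, Matrix.mul_nonsing_inv T hTd, Matrix.mul_one,
      Matrix.nonsing_inv_mul T hTd]
  obtain ⟨V, hV, hVQ⟩ := exists_orthogonal_extension hk hQQ
  refine ⟨V, hV, T, hT1, ?_⟩
  rw [hVQ, hQ, Matrix.smul_mul, smul_smul, mul_inv_cancel₀ hs, one_smul, Matrix.mul_assoc,
    Matrix.nonsing_inv_mul T hTd, Matrix.mul_one]

lemma measurable_matrix_apply {N : ℕ} (i j : Fin N) :
    Measurable fun A : Matrix (Fin N) (Fin N) ℝ => A i j :=
  (measurable_pi_apply j).comp (measurable_pi_apply i)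

lemma measurable_matrix_of_apply {α : Type*} [MeasurableSpace α] {N : ℕ}
    {f : α → Matrix (Fin N) (Fin N) ℝ} (h : ∀ i j, Measurable fun x => f x i j) : Measurable f :=
  measurable_pi_iff.2 fun i => measurable_pi_iff.2 fun j => h i j

lemma measurable_matrix_transpose {N : ℕ} :
    Measurable fun A : Matrix (Fin N) (Fin N) ℝ => Aᵀ :=
  measurable_matrix_of_apply fun i j => measurable_matrix_apply j i

lemma Measurable.matrix_mul {α : Type*} [MeasurableSpace α] {N : ℕ}
    {f g : α → Matrix (Fin N) (Fin N) ℝ} (hf : Measurable f) (hg : Measurable g) :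
    Measurable fun x => f x * g x := by
  refine measurable_matrix_of_apply fun i j => ?_
  simp only [Matrix.mul_apply]
  exact Finset.measurable_sum _ fun l _ =>
    ((measurable_matrix_apply i l).comp hf).mul ((measurable_matrix_apply l j).comp hg)

lemma measurable_matrix_mul_left {N : ℕ} (B : Matrix (Fin N) (Fin N) ℝ) :
    Measurable fun A : Matrix (Fin N) (Fin N) ℝ => B * A :=
  measurable_const.matrix_mul measurable_id

lemma measurable_matrix_mul_right {N : ℕ} (B : Matrix (Fin N) (Fin N) ℝ) :
    Measurable fun A : Matrix (Fin N) (Fin N) ℝ => A * B :=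
  measurable_id.matrix_mul measurable_const

/-- The `m × k` upper left block of `√N • A`. -/
noncomputable def scaledBlock {N m k : ℕ} (hm : m ≤ N) (hk : k ≤ N)
    (A : Matrix (Fin N) (Fin N) ℝ) : Matrix (Fin m) (Fin k) ℝ :=
  Matrix.of fun i j => √N * A (Fin.castLE hm i) (Fin.castLE hk j)

lemma submatrix_mul_eq_scaledBlock_mul {N m k : ℕ} (hm : m ≤ N) (hk : k ≤ N)
    (A V : Matrix (Fin N) (Fin N) ℝ) (T : Matrix (Fin k) (Fin k) ℝ) :
    (A * (√N • (V.submatrix id (Fin.castLE hk) * T))).submatrix (Fin.castLE hm) id =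
      scaledBlock hm hk (A * V) * T := by
  ext i j
  rw [Matrix.mul_smul, ← Matrix.mul_assoc]
  simp only [scaledBlock, Matrix.smul_apply, Matrix.mul_apply, Matrix.of_apply, smul_eq_mul,
    Finset.mul_sum, Matrix.submatrix_apply, id, mul_assoc, Finset.sum_mul]

section Haar

variable {N : ℕ} {μ : Measure (Matrix (Fin N) (Fin N) ℝ)} [IsProbabilityMeasure μ]

lemma ae_mul_transpose_eq_one (h : μ {A | A * Aᵀ = 1} = 1) : ∀ᵐ A ∂μ, A * Aᵀ = 1 := by
  have hm : MeasurableSet {A : Matrix (Fin N) (Fin N) ℝ | A * Aᵀ = 1} := by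
    have he : {A : Matrix (Fin N) (Fin N) ℝ | A * Aᵀ = 1} =
        ⋂ i, ⋂ j, {A | (A * Aᵀ) i j = (1 : Matrix (Fin N) (Fin N) ℝ) i j} := by
      ext A
      simp [← Matrix.ext_iff]
    rw [he]
    exact MeasurableSet.iInter fun i => MeasurableSet.iInter fun j =>
      measurableSet_eq_fun ((measurable_matrix_apply i j).comp
        (measurable_id.matrix_mul measurable_matrix_transpose)) measurable_const
  exact (prob_compl_eq_zero_iff hm).2 h

/-- A left-invariant probability measure on the orthogonal group is invariant under
transposition. -/
lemma map_transpose_eq_of_map_mul_left (hs : ∀ᵐ A ∂μ, A * Aᵀ = 1)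
    (hi : ∀ B : Matrix (Fin N) (Fin N) ℝ, B * Bᵀ = 1 → μ.map (fun A => B * A) = μ) :
    μ.map (fun A => Aᵀ) = μ := by
  refine Measure.ext fun S hS => ?_
  rw [Measure.map_apply measurable_matrix_transpose hS]
  have hT (B : Matrix (Fin N) (Fin N) ℝ) (hB : B * Bᵀ = 1) {S : Set (Matrix (Fin N) (Fin N) ℝ)}
      (hS : MeasurableSet S) : μ ((fun A => Bᵀ * A) ⁻¹' S) = μ S := by
    rw [← Measure.map_apply (measurable_matrix_mul_left Bᵀ) hS,
      hi _ (by rwa [Matrix.transpose_transpose, mul_eq_one_comm])]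
  have hP : MeasurableSet {p : Matrix (Fin N) (Fin N) ℝ × Matrix (Fin N) (Fin N) ℝ |
      p.2ᵀ * p.1 ∈ S} :=
    ((measurable_matrix_transpose.comp measurable_snd).matrix_mul measurable_fst) hS
  have h1 := Measure.prod_apply (μ := μ) (ν := μ) hP
  have h2 := Measure.prod_apply_symm (μ := μ) (ν := μ) hP
  rw [h1] at h2
  rw [lintegral_congr_ae (g := fun _ => μ ((fun A => Aᵀ) ⁻¹' S)),
    lintegral_congr_ae (g := fun _ => μ S) (f := fun y => μ ((fun x => (x, y)) ⁻¹' _))] at h2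
  · simpa using h2
  · filter_upwards [hs] with B hB
    exact hT B hB hS
  · filter_upwards [hs] with A hA
    rw [← hT A hA (measurable_matrix_transpose hS)]
    congr 1
    ext B
    simp

lemma map_mul_right_eq_of_map_mul_left (hs : ∀ᵐ A ∂μ, A * Aᵀ = 1)
    (hi : ∀ B : Matrix (Fin N) (Fin N) ℝ, B * Bᵀ = 1 → μ.map (fun A => B * A) = μ)
    {V : Matrix (Fin N) (Fin N) ℝ} (hV : V * Vᵀ = 1) : μ.map (fun A => A * V) = μ := by
  have ht := map_transpose_eq_of_map_mul_left hs hi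
  have hl := hi Vᵀ (by rwa [Matrix.transpose_transpose, mul_eq_one_comm])
  calc μ.map (fun A => A * V) = (μ.map fun A => Aᵀ).map (fun A => A * V) := by rw [ht]
    _ = (μ.map fun A => Vᵀ * A).map (fun A => Aᵀ) := by
      rw [Measure.map_map (measurable_matrix_mul_right V) measurable_matrix_transpose,
        Measure.map_map measurable_matrix_transpose (measurable_matrix_mul_left Vᵀ)]
      congr 1
      ext A : 1
      simp
    _ = μ := by rw [hl, ht]

/-- Comparison of a block of a Haar orthogonal matrix with a block of a Gaussian matrix. -/
lemma measure_block_mem_le {m k : ℕ} (hs : ∀ᵐ A ∂μ, A * Aᵀ = 1)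
    (hi : ∀ B : Matrix (Fin N) (Fin N) ℝ, B * Bᵀ = 1 → μ.map (fun A => B * A) = μ)
    (hN : 0 < N) (hm : m ≤ N) (hk : k ≤ N) {ε : ℝ} (hε : 0 < ε) (hε1 : ε < 1)
    (h4 : 2 * (k : ℝ) ^ 2 * ∫ x, x ^ 4 ∂gaussianReal 0 1 ≤ N * ε ^ 2)
    {E D : Set (Fin m → Fin k → ℝ)} (hE : MeasurableSet E) (hD : MeasurableSet D)
    (hED : ∀ Y ∈ E, ∀ X : Fin m → Fin k → ℝ,
      ∑ i, ∑ j, (X i j - Y i j) ^ 2 ≤ ε ^ 2 * ∑ i, ∑ j, Y i j ^ 2 → X ∈ D) :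
    μ (scaledBlock hm hk ⁻¹' E) ≤
      2 * stdGaussianPi (Fin N × Fin k) {g | (fun i j => g (Fin.castLE hm i, j)) ∈ D} := by
  set Γ := stdGaussianPi (Fin N × Fin k)
  set S : Set (Fin N × Fin k → ℝ) := {g | ∑ j, ∑ l, ((N : ℝ)⁻¹ * ∑ i, g (i, j) * g (i, l) -
    (1 : Matrix (Fin k) (Fin k) ℝ) j l) ^ 2 ≤ ε ^ 2} with hSdef
  have hS : MeasurableSet S := measurableSet_le (by fun_prop) measurable_const
  have hS2 : 1 / 2 ≤ Γ S := one_half_le_stdGaussianPi_cov hN hε h4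
  let F : Matrix (Fin N) (Fin N) ℝ → (Fin N × Fin k → ℝ) → Fin N × Fin k → ℝ :=
    fun A g q => (A * Matrix.of fun i j => g (i, j)) q.1 q.2
  set D' : Set (Fin N × Fin k → ℝ) := {g | (fun i j => g (Fin.castLE hm i, j)) ∈ D}
  have hD' : MeasurableSet D' :=
    (measurable_pi_iff.2 fun i => measurable_pi_iff.2 fun j => measurable_pi_apply _) hD
  have hEm : MeasurableSet (scaledBlock hm hk ⁻¹' E) :=
    (show Measurable (fun A i j => scaledBlock hm hk A i j) from
      measurable_pi_iff.2 fun i => measurable_pi_iff.2 fun j =>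
        (measurable_matrix_apply _ _).const_mul _) hE
  have hgood : ∀ g ∈ S, μ (scaledBlock hm hk ⁻¹' E) ≤ μ {A | F A g ∈ D'} := by
    intro g hg
    obtain ⟨V, hV, T, hT, hG⟩ := exists_orthogonal_mul_near_one hk hN hε.le hε1
      (Matrix.of fun i j => g (i, j)) hg
    rw [← map_mul_right_eq_of_map_mul_left hs hi hV,
      Measure.map_apply (measurable_matrix_mul_right V) hEm,
      map_mul_right_eq_of_map_mul_left hs hi hV]
    refine measure_mono fun A hA => ?_
    have hX : ∀ i j, F A g (Fin.castLE hm i, j) = (scaledBlock hm hk (A * V) * T) i j := by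
      intro i j
      rw [← submatrix_mul_eq_scaledBlock_mul, ← hG]
      rfl
    have hle : ∑ i, ∑ j, (scaledBlock hm hk (A * V) * (T - 1) : Matrix (Fin m) (Fin k) ℝ) i j ^ 2 ≤
        ε ^ 2 * ∑ i, ∑ j, scaledBlock hm hk (A * V) i j ^ 2 := by
      rw [mul_comm]
      exact (sum_sq_mul_le _ _).trans (by gcongr)
    refine hED (scaledBlock hm hk (A * V)) hA (fun i j => F A g (Fin.castLE hm i, j)) ?_
    simp only [hX]
    simpa only [Matrix.mul_sub, Matrix.mul_one, Matrix.sub_apply] using hle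
  have hF : Measurable fun p : Matrix (Fin N) (Fin N) ℝ × (Fin N × Fin k → ℝ) => F p.1 p.2 := by
    refine measurable_pi_iff.2 fun q => ?_
    simp only [F, Matrix.mul_apply, Matrix.of_apply]
    exact Finset.measurable_sum _ fun l _ =>
      ((measurable_matrix_apply _ _).comp measurable_fst).mul
        ((measurable_pi_apply _).comp measurable_snd)
  have hP := hF hD'
  have h2 : ∫⁻ A, Γ {g | F A g ∈ D'} ∂μ = ∫⁻ g, μ {A | F A g ∈ D'} ∂Γ :=
    (Measure.prod_apply (μ := μ) (ν := Γ) hP).symm.trans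
      (Measure.prod_apply_symm (μ := μ) (ν := Γ) hP)
  have hae : (fun A => Γ {g | F A g ∈ D'}) =ᵐ[μ] fun _ => Γ D' := by
    filter_upwards [hs] with A hA
    have hFA : Measurable (F A) := hF.comp (measurable_const.prodMk measurable_id)
    have hmap : Γ.map (F A) = Γ := stdGaussianPi_map_mul hA
    calc Γ (F A ⁻¹' D') = Γ.map (F A) D' := (Measure.map_apply hFA hD').symm
      _ = Γ D' := by rw [hmap]
  rw [lintegral_congr_ae hae, lintegral_const, measure_univ, mul_one] at h2
  have h3 : μ (scaledBlock hm hk ⁻¹' E) * Γ S ≤ Γ D' := by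
    rw [← setLIntegral_const]
    calc ∫⁻ _ in S, μ (scaledBlock hm hk ⁻¹' E) ∂Γ
        ≤ ∫⁻ g in S, μ {A | F A g ∈ D'} ∂Γ := setLIntegral_mono' hS hgood
      _ ≤ ∫⁻ g, μ {A | F A g ∈ D'} ∂Γ := setLIntegral_le_lintegral _ _
      _ = Γ D' := h2.symm
  calc μ (scaledBlock hm hk ⁻¹' E) = 2 * (μ (scaledBlock hm hk ⁻¹' E) * (1 / 2)) := by
        rw [mul_comm (μ _), ← mul_assoc, one_div, ENNReal.mul_inv_cancel (by simp) (by simp),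
          one_mul]
    _ ≤ 2 * (μ (scaledBlock hm hk ⁻¹' E) * Γ S) := by gcongr
    _ ≤ 2 * Γ D' := by gcongr

end Haar

/-- The sum of `f` over the scaled entries of the `m × k` upper left block of `A`. -/
noncomputable def entrySum (m k N : ℕ) (f : ℝ → ℝ) (A : Matrix (Fin N) (Fin N) ℝ) : ℝ :=
  ∑ i ∈ Finset.range m, ∑ j ∈ Finset.range k, f (√N * entryOrZero A i j)

lemma entrySum_eq_sum_scaledBlock {m k N : ℕ} (hm : m ≤ N) (hk : k ≤ N) (f : ℝ → ℝ)
    (A : Matrix (Fin N) (Fin N) ℝ) :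
    entrySum m k N f A = ∑ i, ∑ j, f (scaledBlock hm hk A i j) := by
  rw [entrySum, Finset.sum_range]
  refine Finset.sum_congr rfl fun i _ => ?_
  rw [Finset.sum_range]
  refine Finset.sum_congr rfl fun j _ => ?_
  rw [entryOrZero, dif_pos ⟨i.2.trans_le hm, j.2.trans_le hk⟩]
  rfl

lemma entrySum_transpose (m k N : ℕ) (f : ℝ → ℝ) (A : Matrix (Fin N) (Fin N) ℝ) :
    entrySum m k N f Aᵀ = entrySum k m N f A := by
  rw [entrySum, entrySum, Finset.sum_comm]
  refine Finset.sum_congr rfl fun i _ => Finset.sum_congr rfl fun j _ => ?_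
  simp only [entryOrZero, and_comm, Matrix.transpose_apply]

lemma measurable_entrySum (m k N : ℕ) {f : ℝ → ℝ} (hf : Measurable f) :
    Measurable (entrySum m k N f) := by
  refine Finset.measurable_sum _ fun i _ => Finset.measurable_sum _ fun j _ => hf.comp ?_
  refine Measurable.const_mul ?_ _
  unfold entryOrZero
  split_ifs
  · exact measurable_matrix_apply _ _
  · exact measurable_const

section Haar

variable {N : ℕ} {μ : Measure (Matrix (Fin N) (Fin N) ℝ)} [IsProbabilityMeasure μ]

lemma measure_entrySum_mem_le_of_le {m k : ℕ} (hkm : k ≤ m) (hs : ∀ᵐ A ∂μ, A * Aᵀ = 1)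
    (hi : ∀ B : Matrix (Fin N) (Fin N) ℝ, B * Bᵀ = 1 → μ.map (fun A => B * A) = μ)
    (hN : 0 < N) (hm : m ≤ N) (hk : k ≤ N) {ε : ℝ} (hε : 0 < ε) (hε1 : ε < 1)
    (h4 : 2 * ((m * k : ℕ) : ℝ) * ∫ x, x ^ 4 ∂gaussianReal 0 1 ≤ N * ε ^ 2)
    {f h : ℝ → ℝ} (hf : Measurable f) (hh : Measurable h) {P : Set (ℝ × ℝ)} (hP : MeasurableSet P)
    {t : ℝ} (hPt : ∀ (ι : Type) [Fintype ι], Fintype.card ι = m * k → ∀ x y : ι → ℝ,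
      (∑ i, y i ^ 2, ∑ i, f (y i)) ∈ P → ∑ i, (x i - y i) ^ 2 ≤ ε ^ 2 * ∑ i, y i ^ 2 →
      t ≤ ∑ i, h (x i))
    {c : ENNReal} (hc : ∀ (ι : Type) [Fintype ι] [DecidableEq ι] (s : Finset ι), s.card = m * k →
      stdGaussianPi ι {g | t ≤ ∑ i ∈ s, h (g i)} ≤ c) :
    μ {A | (entrySum m k N (fun x => x ^ 2) A, entrySum m k N f A) ∈ P} ≤ 2 * c := by
  have h4' : 2 * (k : ℝ) ^ 2 * ∫ x, x ^ 4 ∂gaussianReal 0 1 ≤ N * ε ^ 2 := by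
    refine le_trans ?_ h4
    have h0 : 0 ≤ ∫ x, x ^ 4 ∂gaussianReal 0 1 := integral_nonneg fun x => by positivity
    have : (k : ℝ) ^ 2 ≤ ((m * k : ℕ) : ℝ) := by
      rw [sq]; push_cast; gcongr
    gcongr
  let E : Set (Fin m → Fin k → ℝ) := {Y | (∑ i, ∑ j, Y i j ^ 2, ∑ i, ∑ j, f (Y i j)) ∈ P}
  let D : Set (Fin m → Fin k → ℝ) := {X | t ≤ ∑ i, ∑ j, h (X i j)}
  have hsum (f : ℝ → ℝ) (hf : Measurable f) :
      Measurable fun Y : Fin m → Fin k → ℝ => ∑ i, ∑ j, f (Y i j) :=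
    Finset.measurable_sum _ fun i _ => Finset.measurable_sum _ fun j _ =>
      hf.comp ((measurable_pi_apply j).comp (measurable_pi_apply i))
  have hE : MeasurableSet E := ((hsum (fun x => x ^ 2) (by fun_prop)).prodMk (hsum f hf)) hP
  have hD : MeasurableSet D := measurableSet_le measurable_const (hsum h hh)
  have key := measure_block_mem_le hs hi hN hm hk hε hε1 h4' hE hD fun Y hY X hXY => by
    have := hPt (Fin m × Fin k) (by simp) (fun q => X q.1 q.2) (fun q => Y q.1 q.2)
    simp only [Fintype.sum_prod_type] at this
    exact this hY hXY
  calc _ = μ (scaledBlock hm hk ⁻¹' E) := by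
        simp only [entrySum_eq_sum_scaledBlock hm hk]
        rfl
    _ ≤ _ := key
    _ ≤ 2 * c := by
      gcongr
      let e : Fin m × Fin k ↪ Fin N × Fin k :=
        (Fin.castLEEmb hm).prodMap (Function.Embedding.refl _)
      have := hc (Fin N × Fin k) (Finset.univ.map e) (by simp)
      simp only [Finset.sum_map, Fintype.sum_prod_type] at this
      exact this

lemma measure_entrySum_mem_le {m k : ℕ} (hs : ∀ᵐ A ∂μ, A * Aᵀ = 1)
    (hi : ∀ B : Matrix (Fin N) (Fin N) ℝ, B * Bᵀ = 1 → μ.map (fun A => B * A) = μ)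
    (hN : 0 < N) (hm : m ≤ N) (hk : k ≤ N) {ε : ℝ} (hε : 0 < ε) (hε1 : ε < 1)
    (h4 : 2 * ((m * k : ℕ) : ℝ) * ∫ x, x ^ 4 ∂gaussianReal 0 1 ≤ N * ε ^ 2)
    {f h : ℝ → ℝ} (hf : Measurable f) (hh : Measurable h) {P : Set (ℝ × ℝ)} (hP : MeasurableSet P)
    {t : ℝ} (hPt : ∀ (ι : Type) [Fintype ι], Fintype.card ι = m * k → ∀ x y : ι → ℝ,
      (∑ i, y i ^ 2, ∑ i, f (y i)) ∈ P → ∑ i, (x i - y i) ^ 2 ≤ ε ^ 2 * ∑ i, y i ^ 2 →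
      t ≤ ∑ i, h (x i))
    {c : ENNReal} (hc : ∀ (ι : Type) [Fintype ι] [DecidableEq ι] (s : Finset ι), s.card = m * k →
      stdGaussianPi ι {g | t ≤ ∑ i ∈ s, h (g i)} ≤ c) :
    μ {A | (entrySum m k N (fun x => x ^ 2) A, entrySum m k N f A) ∈ P} ≤ 2 * c := by
  rcases le_total k m with hkm | hkm
  · exact measure_entrySum_mem_le_of_le hkm hs hi hN hm hk hε hε1 h4 hf hh hP hPt hc
  · rw [mul_comm m k] at h4 hPt hc
    have hS : MeasurableSet {A : Matrix (Fin N) (Fin N) ℝ |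
        (entrySum m k N (fun x => x ^ 2) A, entrySum m k N f A) ∈ P} :=
      ((measurable_entrySum m k N (by fun_prop)).prodMk (measurable_entrySum m k N hf)) hP
    rw [← map_transpose_eq_of_map_mul_left hs hi, Measure.map_apply measurable_matrix_transpose hS]
    simp only [Set.preimage_ofPred_eq, entrySum_transpose]
    exact measure_entrySum_mem_le_of_le hkm hs hi hN hk hm hε hε1 h4 hf hh hP hPt hc

/-- Exponential tail bound for the sum of squares of the entries. -/
lemma measure_entrySum_sq_ge_le {a M : ℝ}
    (hM : ∀ (ι : Type) [Fintype ι] [DecidableEq ι] (s : Finset ι),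
      stdGaussianPi ι {g | M * s.card ≤ ∑ i ∈ s, g i ^ 2} ≤
        ENNReal.ofReal (Real.exp (-(a * s.card))))
    {m k : ℕ} (hs : ∀ᵐ A ∂μ, A * Aᵀ = 1)
    (hi : ∀ B : Matrix (Fin N) (Fin N) ℝ, B * Bᵀ = 1 → μ.map (fun A => B * A) = μ)
    (hN : 0 < N) (hm : m ≤ N) (hk : k ≤ N)
    (h4 : 2 * ((m * k : ℕ) : ℝ) * ∫ x, x ^ 4 ∂gaussianReal 0 1 ≤ N * (1 / 2) ^ 2) :
    μ {A | 4 * M * (m * k : ℕ) ≤ entrySum m k N (fun x => x ^ 2) A} ≤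
      2 * ENNReal.ofReal (Real.exp (-(a * (m * k : ℕ)))) := by
  refine measure_entrySum_mem_le (P := {q | 4 * M * (m * k : ℕ) ≤ q.1}) (f := fun x => x)
    (h := fun x => x ^ 2) (t := M * (m * k : ℕ)) (ε := 1 / 2) hs hi hN hm hk (by norm_num)
    (by norm_num) h4 (by fun_prop) (by fun_prop)
    (measurableSet_le (by fun_prop) (by fun_prop)) ?_ ?_
  · intro ι _ hι x y hy hxy
    have hy' : 4 * M * (m * k : ℕ) ≤ ∑ i, y i ^ 2 := hy
    have h1 : ∑ i, y i ^ 2 ≤ 2 * ∑ i, x i ^ 2 + 2 * ∑ i, (x i - y i) ^ 2 := by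
      rw [Finset.mul_sum, Finset.mul_sum, ← Finset.sum_add_distrib]
      exact Finset.sum_le_sum fun i _ => by nlinarith [sq_nonneg (2 * x i - y i)]
    linarith
  · intro ι _ _ s hs
    rw [← hs]
    exact hM ι s

/-- Upper bound of Cramér type for the entries, on the event that the sum of their squares is of
the expected order. -/
lemma exists_measure_entrySum_ge_le {f : ℝ → ℝ} (hf : UniformContinuous f)
    (hb : ∃ B, ∀ x, |f x| ≤ B) (M t : ℝ) {δ : ℝ} (hδ : 0 < δ) :
    ∃ ε, 0 < ε ∧ ∀ {N : ℕ} {μ : Measure (Matrix (Fin N) (Fin N) ℝ)} [IsProbabilityMeasure μ]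
      {m k : ℕ} (_ : ∀ᵐ A ∂μ, A * Aᵀ = 1)
      (_ : ∀ B : Matrix (Fin N) (Fin N) ℝ, B * Bᵀ = 1 → μ.map (fun A => B * A) = μ)
      (_ : 0 < N) (_ : m ≤ N) (_ : k ≤ N)
      (_ : 2 * ((m * k : ℕ) : ℝ) * ∫ x, x ^ 4 ∂gaussianReal 0 1 ≤ N * ε ^ 2),
      μ {A | entrySum m k N (fun x => x ^ 2) A ≤ M * (m * k : ℕ) ∧
          (t + Real.log (∫ x, Real.exp (f x) ∂gaussianReal 0 1)) * (m * k : ℕ) ≤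
            entrySum m k N f A} ≤
        2 * ENNReal.ofReal (Real.exp (-((t - δ) * (m * k : ℕ)))) := by
  obtain ⟨B, hB⟩ := hb
  have hB0 : 0 ≤ B := (abs_nonneg _).trans (hB 0)
  obtain ⟨r, hr, hr'⟩ := Metric.uniformContinuous_iff.1 hf (δ / 2) (half_pos hδ)
  set K := 2 * B / r ^ 2
  have hK : 0 ≤ K := by positivity
  have hfd : ∀ x y, f y ≤ f x + δ / 2 + K * (x - y) ^ 2 := by
    intro x y
    rcases lt_or_ge |x - y| r with h | h
    · have := hr' (a := x) (b := y) (by rwa [Real.dist_eq])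
      rw [Real.dist_eq, abs_lt] at this
      nlinarith [mul_nonneg hK (sq_nonneg (x - y))]
    · have h1 : 2 * B ≤ K * (x - y) ^ 2 := by
        rw [← sq_abs (x - y), div_mul_eq_mul_div, le_div_iff₀ (by positivity)]
        gcongr
      linarith [(abs_le.1 (hB x)).1, (abs_le.1 (hB y)).2]
  set L := K * |M| + 1
  have hL : 0 < L := by positivity
  obtain ⟨ε, hε, hε1, hεδ⟩ : ∃ ε : ℝ, 0 < ε ∧ ε < 1 ∧ ε * L ≤ δ / 2 := by
    refine ⟨min (1 / 2) (δ / 2 / L), by positivity, (min_le_left _ _).trans_lt (by norm_num), ?_⟩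
    rw [← le_div_iff₀ hL]
    exact min_le_right _ _
  refine ⟨ε, hε, fun {N μ} _ {m k} hs hi hN hm hk h4 => ?_⟩
  set Λ := Real.log (∫ x, Real.exp (f x) ∂gaussianReal 0 1)
  have hint : Integrable (fun x => Real.exp (f x)) (gaussianReal 0 1) := by
    refine Integrable.of_bound (C := Real.exp B) ?_ (ae_of_all _ fun x => ?_)
    · exact (Real.continuous_exp.comp hf.continuous).aestronglyMeasurable
    · rw [Real.norm_eq_abs, Real.abs_exp]
      exact Real.exp_le_exp.2 (abs_le.1 (hB x)).2
  have hpos : 0 < ∫ x, Real.exp (f x) ∂gaussianReal 0 1 := integral_exp_pos hint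
  have hmf := hf.continuous.measurable
  have hP : MeasurableSet ({q : ℝ × ℝ | q.1 ≤ M * (m * k : ℕ)} ∩
      {q | (t + Λ) * (m * k : ℕ) ≤ q.2}) :=
    (measurableSet_le (by fun_prop) (by fun_prop)).inter
      (measurableSet_le (by fun_prop) (by fun_prop))
  refine measure_entrySum_mem_le (f := f)
    (h := f) (t := (t - δ + Λ) * (m * k : ℕ)) (ε := ε) hs hi hN hm hk hε hε1 h4 hmf hmf hP ?_ ?_
  · rintro ι _ hι x y ⟨hy1, hy2⟩ hxy
    simp only [Set.mem_ofPred_eq] at hy1 hy2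
    have h1 : ∑ i, f (y i) ≤ ∑ i, f (x i) + δ / 2 * (m * k : ℕ) + K * ∑ i, (x i - y i) ^ 2 := by
      calc ∑ i, f (y i) ≤ ∑ i, (f (x i) + δ / 2 + K * (x i - y i) ^ 2) :=
            Finset.sum_le_sum fun i _ => hfd _ _
        _ = _ := by
          rw [Finset.sum_add_distrib, Finset.sum_add_distrib, ← Finset.mul_sum, Finset.sum_const,
            Finset.card_univ, hι, nsmul_eq_mul, mul_comm (δ / 2)]
    have hp : (0 : ℝ) ≤ (m * k : ℕ) := Nat.cast_nonneg _
    have h2 : K * ∑ i, (x i - y i) ^ 2 ≤ δ / 2 * (m * k : ℕ) := by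
      calc K * ∑ i, (x i - y i) ^ 2 ≤ K * (ε ^ 2 * (|M| * (m * k : ℕ))) := by
            gcongr
            refine hxy.trans ?_
            gcongr
            exact hy1.trans (by gcongr; exact le_abs_self M)
        _ = ε * (ε * (K * |M|)) * (m * k : ℕ) := by ring
        _ ≤ 1 * (ε * L) * (m * k : ℕ) := by
          gcongr
          exact (lt_add_one _).le
        _ ≤ _ := by rw [one_mul]; gcongr
    nlinarith
  · intro ι _ _ s hs
    refine (stdGaussianPi_sum_ge_le s hint _).trans (le_of_eq ?_)
    rw [hs, ← Real.exp_log hpos, ← Real.exp_nat_mul, ← Real.exp_add]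
    congr 2
    ring

end Haar

lemma isProbabilityMeasure_empMeas {m k : ℕ} (h : 0 < m * k) (N : ℕ)
    (A : Matrix (Fin N) (Fin N) ℝ) : IsProbabilityMeasure (empMeas m k N A) := by
  constructor
  simp only [empMeas, Measure.smul_apply, Measure.finsetSum_apply, measure_univ, Finset.sum_const,
    Finset.card_range, nsmul_eq_mul, mul_one, smul_eq_mul]
  rw [← Nat.cast_mul]
  exact ENNReal.inv_mul_cancel (by exact_mod_cast h.ne') (ENNReal.natCast_ne_top _)

lemma coe_empPM {m k : ℕ} (h : 0 < m * k) (N : ℕ) (A : Matrix (Fin N) (Fin N) ℝ) :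
    (empPM m k N A : Measure ℝ) = empMeas m k N A := by
  have he : empPM m k N A = ⟨empMeas m k N A, isProbabilityMeasure_empMeas h N A⟩ :=
    dif_pos (isProbabilityMeasure_empMeas h N A)
  rw [he, ProbabilityMeasure.coe_mk]

lemma integrable_empMeas {m k : ℕ} (h : 0 < m * k) (N : ℕ) (A : Matrix (Fin N) (Fin N) ℝ)
    (f : ℝ → ℝ) : Integrable f (empMeas m k N A) :=
  Integrable.smul_measure (integrable_finsetSum_measure.2 fun _ _ =>
    integrable_finsetSum_measure.2 fun _ _ => integrable_dirac (by simp))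
    (ENNReal.inv_ne_top.2 (by exact_mod_cast h.ne'))

lemma integral_empMeas (m k N : ℕ) (A : Matrix (Fin N) (Fin N) ℝ) (f : ℝ → ℝ) :
    ∫ x, f x ∂empMeas m k N A = entrySum m k N f A / (m * k : ℕ) := by
  have hd : ∀ a : ℝ, Integrable f (Measure.dirac a) := fun a => integrable_dirac (by simp)
  rw [empMeas, integral_smul_measure, integral_finsetSum_measure fun _ _ =>
    integrable_finsetSum_measure.2 fun _ _ => hd _]
  simp only [integral_finsetSum_measure fun _ _ => hd _, integral_dirac, entrySum, smul_eq_mul,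
    ENNReal.toReal_inv, ENNReal.toReal_natCast]
  rw [div_eq_inv_mul]

/-- Probability measures whose second moment is at most `M`, in the sense of Markov's
inequality. -/
def secondMomentBounded (M : ℝ) : Set (ProbabilityMeasure ℝ) :=
  {ν | ∀ r, r * (ν : Measure ℝ).real {x | r ≤ x ^ 2} ≤ M}

lemma isCompact_closure_secondMomentBounded (M : ℝ) :
    IsCompact (closure (secondMomentBounded M)) := by
  refine isCompact_closure_of_isTightMeasureSet ?_
  rw [isTightMeasureSet_iff_exists_isCompact_measure_compl_le]
  intro ε hε
  rcases eq_or_ne ε ⊤ with rfl | hε'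
  · exact ⟨∅, isCompact_empty, fun _ _ => le_top⟩
  have he : 0 < ε.toReal := ENNReal.toReal_pos hε.ne' hε'
  set r := |M| / ε.toReal + 1
  have hr : 0 < r := by positivity
  refine ⟨Metric.closedBall 0 √r, isCompact_closedBall _ _, ?_⟩
  rintro _ ⟨ν, hν, rfl⟩
  refine (measure_mono (t := {x | r ≤ x ^ 2}) fun x hx => ?_).trans ?_
  · rw [Set.mem_compl_iff, mem_closedBall_zero_iff, not_le, Real.norm_eq_abs] at hx
    exact ((Real.sqrt_lt' ((Real.sqrt_nonneg _).trans_lt hx)).1 hx).le.trans (sq_abs x).le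
  · rw [← ENNReal.ofReal_toReal hε', ← ofReal_measureReal]
    refine ENNReal.ofReal_le_ofReal ?_
    refine le_of_mul_le_mul_left ?_ hr
    refine (hν r).trans ((le_abs_self M).trans ?_)
    rw [add_mul, div_mul_cancel₀ _ he.ne']
    linarith

lemma empPM_mem_secondMomentBounded {m k : ℕ} (h : 0 < m * k) {N : ℕ}
    {A : Matrix (Fin N) (Fin N) ℝ} {M : ℝ}
    (hA : entrySum m k N (fun x => x ^ 2) A ≤ M * (m * k : ℕ)) :
    empPM m k N A ∈ secondMomentBounded M := by
  intro r
  rw [coe_empPM h]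
  refine (mul_meas_ge_le_integral_of_nonneg (ae_of_all _ fun x => sq_nonneg x)
    (integrable_empMeas h N A _) r).trans ?_
  rw [integral_empMeas, div_le_iff₀ (by exact_mod_cast h)]
  exact hA

lemma exists_finset_forall_lt_integral {γ : Measure ℝ} [IsProbabilityMeasure γ]
    {C : Set (ProbabilityMeasure ℝ)} (hC : IsClosed C) {a : ℝ}
    (ha : ∀ ν ∈ C, (a : EReal) < relEntropy (ν : Measure ℝ) γ) (M : ℝ) :
    ∃ F : Finset {f : ℝ → ℝ // UniformContinuous f ∧ ∃ B, ∀ x, |f x| ≤ B},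
      ∀ ν ∈ C, ν ∈ secondMomentBounded M →
        ∃ f ∈ F, a + Real.log (∫ x, Real.exp (f.1 x) ∂γ) < ∫ x, f.1 x ∂(ν : Measure ℝ) := by
  have hK := (isCompact_closure_secondMomentBounded M).inter_left hC
  obtain ⟨F, hF⟩ := hK.elim_finite_subcover
    (fun f : {f : ℝ → ℝ // UniformContinuous f ∧ ∃ B, ∀ x, |f x| ≤ B} =>
      {ν : ProbabilityMeasure ℝ |
        a + Real.log (∫ x, Real.exp (f.1 x) ∂γ) < ∫ x, f.1 x ∂(ν : Measure ℝ)})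
    (fun f => by
      obtain ⟨B, hB⟩ := f.2.2
      exact isOpen_lt continuous_const
        (ProbabilityMeasure.continuous_integral_boundedContinuousFunction
          (BoundedContinuousFunction.ofNormedAddCommGroup f.1 f.2.1.continuous B hB)))
    (fun ν hν => by
      obtain ⟨f, hf, hb, hlt⟩ := exists_uniformContinuous_of_lt_relEntropy (ha ν hν.1)
      exact Set.mem_iUnion.2 ⟨⟨f, hf, hb⟩, hlt⟩)
  refine ⟨F, fun ν hν hνM => ?_⟩
  simpa using hF ⟨hν, subset_closure hνM⟩

lemma eventually_mul_le_of_isLittleO {u : ℕ → ℝ} (hu : u =o[atTop] fun N => (N : ℝ)) {c : ℝ}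
    (hc : 0 ≤ c) {ε : ℝ} (hε : 0 < ε) : ∀ᶠ N in atTop, 2 * u N * c ≤ N * ε ^ 2 := by
  have h := hu.bound (show 0 < ε ^ 2 / (2 * c + 1) by positivity)
  filter_upwards [h] with N hN
  rw [Real.norm_eq_abs, Real.norm_natCast, div_mul_eq_mul_div, le_div_iff₀ (by positivity)] at hN
  nlinarith [le_abs_self (u N), abs_nonneg (u N), mul_le_mul_of_nonneg_right (le_abs_self (u N)) hc]

lemma limsup_inv_mul_log_le {p : ℕ → ℕ} (hp : Tendsto p atTop atTop) {u : ℕ → ENNReal} {a c : ℝ}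
    (hc : 0 < c) (hu : ∀ᶠ N in atTop, u N ≤ ENNReal.ofReal (c * Real.exp (-(a * p N)))) :
    limsup (fun N => (((p N : ℝ)) : EReal)⁻¹ * ENNReal.log (u N)) atTop ≤ ((-a : ℝ) : EReal) := by
  have ht : Tendsto (fun N => ((Real.log c * (p N : ℝ)⁻¹ - a : ℝ) : EReal)) atTop
      (nhds ((-a : ℝ) : EReal)) := by
    refine (continuous_coe_real_ereal.tendsto _).comp ?_
    have h1 := (tendsto_inv_atTop_zero.comp (tendsto_natCast_atTop_atTop (R := ℝ))).comp hp
    simpa using (h1.const_mul (Real.log c)).sub_const a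
  rw [← ht.limsup_eq]
  refine limsup_le_limsup ?_
  filter_upwards [hu, hp.eventually_gt_atTop 0] with N hN hpN
  have hp' : (0 : ℝ) < p N := by exact_mod_cast hpN
  rw [← EReal.coe_inv]
  calc (((p N : ℝ)⁻¹ : ℝ) : EReal) * ENNReal.log (u N)
      ≤ (((p N : ℝ)⁻¹ : ℝ) : EReal) *
        ENNReal.log (ENNReal.ofReal (c * Real.exp (-(a * p N)))) :=
        mul_le_mul_of_nonneg_left (ENNReal.log_monotone hN) (by exact_mod_cast (inv_pos.2 hp').le)
    _ = _ := by
      rw [ENNReal.log_ofReal_of_pos (by positivity), ← EReal.coe_mul,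
        Real.log_mul hc.ne' (Real.exp_pos _).ne', Real.log_exp]
      congr 1
      field_simp
      ring

/-- **LDP upper bound for the empirical measure of scaled entries of a Haar orthogonal
matrix.** Here `μ N` is the Haar probability measure on `O(N)`, viewed as a measure on
`N × N` matrices: it is a probability measure, concentrated on orthogonal matrices, and
invariant under left multiplication by orthogonal matrices. -/
theorem stmt_0
    (m k : ℕ → ℕ)
    (hp_top : Tendsto (fun N => m N * k N) atTop atTop)
    (hp_o : (fun N => (m N * k N : ℝ)) =o[atTop] fun N => (N : ℝ))
    (μ : (N : ℕ) → Measure (Matrix (Fin N) (Fin N) ℝ))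
    (hμ_prob : ∀ N, IsProbabilityMeasure (μ N))
    (hμ_supp : ∀ N, μ N {A | A * Aᵀ = 1} = 1)
    (hμ_inv : ∀ N (B : Matrix (Fin N) (Fin N) ℝ), B * Bᵀ = 1 →
      (μ N).map (fun A => B * A) = μ N)
    (C : Set (ProbabilityMeasure ℝ)) (hC : IsClosed C) :
    Filter.limsup
        (fun N => (((m N * k N : ℝ))⁻¹ : EReal) *
          ENNReal.log (μ N {A | empPM (m N) (k N) N A ∈ C})) atTop
      ≤ - ⨅ ν ∈ C, relEntropy (ν : Measure ℝ) (gaussianReal 0 1) := by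
  simp only [← Nat.cast_mul] at hp_o ⊢
  rw [EReal.le_neg]
  refine le_of_forall_lt fun b hb => ?_
  obtain ⟨a, hba, haI⟩ := EReal.lt_iff_exists_real_btwn.1 hb
  refine hba.trans_le ?_
  rw [EReal.le_neg, ← EReal.coe_neg]
  obtain ⟨t, hat, htI⟩ := EReal.lt_iff_exists_real_btwn.1 haI
  have hat' : a < t := EReal.coe_lt_coe_iff.1 hat
  obtain ⟨M, -, hM⟩ := exists_stdGaussianPi_sum_sq_ge_le a
  obtain ⟨F, hF⟩ := exists_finset_forall_lt_integral (γ := gaussianReal 0 1) hC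
    (fun ν hν => htI.trans_le (iInf₂_le ν hν)) (4 * M)
  choose ε hε hεb using fun f : {f : ℝ → ℝ // UniformContinuous f ∧ ∃ B, ∀ x, |f x| ≤ B} =>
    exists_measure_entrySum_ge_le f.2.1 f.2.2 (4 * M) t (sub_pos.2 hat')
  have hK : 0 ≤ ∫ x, x ^ 4 ∂gaussianReal 0 1 := integral_nonneg fun x => by positivity
  have hc : (0 : ℝ) < 2 + F.card * 2 := by positivity
  refine limsup_inv_mul_log_le hp_top hc ?_
  filter_upwards [hp_top.eventually_gt_atTop 0, eventually_gt_atTop 0,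
    hp_o.bound one_pos, eventually_mul_le_of_isLittleO hp_o hK (ε := 1 / 2) (by norm_num),
    (Finset.eventually_all F).2 fun f _ => eventually_mul_le_of_isLittleO hp_o hK (hε f)]
    with N hp hN hpN h2 hFN
  have := hμ_prob N
  have hs := ae_mul_transpose_eq_one (hμ_supp N)
  have hpN' : m N * k N ≤ N := by
    rw [one_mul, Real.norm_natCast, Real.norm_natCast] at hpN
    exact_mod_cast hpN
  have hm : m N ≤ N := (Nat.le_mul_of_pos_right _ (Nat.pos_of_mul_pos_left hp)).trans hpN'
  have hk : k N ≤ N := (Nat.le_mul_of_pos_left _ (Nat.pos_of_mul_pos_right hp)).trans hpN'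
  set p : ℝ := ((m N * k N : ℕ) : ℝ) with hpdef
  have hp0 : 0 < p := by rw [hpdef]; exact_mod_cast hp
  calc μ N {A | empPM (m N) (k N) N A ∈ C}
      ≤ μ N ({A | 4 * M * p ≤ entrySum (m N) (k N) N (fun x => x ^ 2) A} ∪
          ⋃ f ∈ F, {A | entrySum (m N) (k N) N (fun x => x ^ 2) A ≤ 4 * M * p ∧
            (t + Real.log (∫ x, Real.exp (f.1 x) ∂gaussianReal 0 1)) * p ≤
              entrySum (m N) (k N) N f.1 A}) := by
        refine measure_mono fun A hA => ?_
        rcases le_total (4 * M * p) (entrySum (m N) (k N) N (fun x => x ^ 2) A) with h | h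
        · exact Or.inl h
        · obtain ⟨f, hf, hlt⟩ := hF _ hA (empPM_mem_secondMomentBounded hp h)
          refine Or.inr (Set.mem_iUnion₂.2 ⟨f, hf, h, ?_⟩)
          rw [coe_empPM hp, integral_empMeas, lt_div_iff₀ hp0] at hlt
          exact hlt.le
    _ ≤ 2 * ENNReal.ofReal (Real.exp (-(a * p))) +
          ∑ f ∈ F, 2 * ENNReal.ofReal (Real.exp (-(a * p))) := by
        refine (measure_union_le _ _).trans (add_le_add ?_ ?_)
        · exact measure_entrySum_sq_ge_le hM hs (hμ_inv N) hN hm hk h2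
        · refine (measure_biUnion_finset_le _ _).trans (Finset.sum_le_sum fun f hf => ?_)
          have := hεb f hs (hμ_inv N) hN hm hk (hFN f hf)
          rwa [sub_sub_cancel] at this
    _ = ENNReal.ofReal ((2 + F.card * 2) * Real.exp (-(a * p))) := by
        rw [Finset.sum_const, nsmul_eq_mul, ENNReal.ofReal_mul hc.le,
          ENNReal.ofReal_add (by norm_num) (by positivity), ENNReal.ofReal_mul (by positivity),
          ENNReal.ofReal_natCast, ENNReal.ofReal_ofNat]
        ring
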